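/- Let n ≥ 3 and let F : 𝔽₂ⁿ → 𝔽₂^(n−2) be a function with differential uniformity k = Δ_F. Set δ_k = 0 if k ≡ 0 (mod 4) and δ_k = 2 otherwise. Then the ambiguity satisfies 𝒜(F) ≥ 3·2^(n−1)·(2ⁿ − 1) + k·(k − 4)/2 − δ_k. -/

import Mathlib

open Finset

/-- `δ_F(a,b) = |{x : F(x+a) - F(x) = b}|`. -/
def deltaF {G₁ G₂ : Type*} [AddCommGroup G₁] [Fintype G₁] [DecidableEq G₁]
    [AddCommGroup G₂] [DecidableEq G₂] (F : G₁ → G₂) (a : G₁) (b : G₂) : ℕ :=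
  (univ.filter fun x => F (x + a) - F x = b).card

/-- The ambiguity `𝒜(F) = Σ_{a ≠ 0} Σ_b (δ_F(a,b) choose 2)`. -/
def ambiguity {G₁ G₂ : Type*} [AddCommGroup G₁] [Fintype G₁] [DecidableEq G₁]
    [AddCommGroup G₂] [Fintype G₂] [DecidableEq G₂] (F : G₁ → G₂) : ℕ :=
  ∑ a ∈ univ.filter (fun a : G₁ => a ≠ 0), ∑ b : G₂, (deltaF F a b).choose 2

/-- The differential uniformity `Δ_F = max_{a ≠ 0, b} δ_F(a,b)`. -/
def diffUnif {G₁ G₂ : Type*} [AddCommGroup G₁] [Fintype G₁] [DecidableEq G₁]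
    [AddCommGroup G₂] [Fintype G₂] [DecidableEq G₂] (F : G₁ → G₂) : ℕ :=
  (univ.filter (fun a : G₁ => a ≠ 0)).sup fun a => univ.sup fun b : G₂ => deltaF F a b

/-- A fixed-point-free involution preserves no set of odd size. -/
lemma even_card_filter_of_involution {α : Type*} [Fintype α] [DecidableEq α] (p : α → Prop)
    [DecidablePred p] (f : α → α) (hf : ∀ x, f (f x) = x) (hne : ∀ x, p x → f x ≠ x)
    (hp : ∀ x, p x → p (f x)) : Even (univ.filter p).card := by
  have h : (∑ x ∈ univ.filter p, (1 : ZMod 2)) = 0 := by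
    refine sum_involution (fun x _ => f x) ?_ ?_ ?_ ?_
    · intro a _
      decide
    · intro a ha _
      exact hne a (by simpa using ha)
    · intro a ha
      simpa using hp a (by simpa using ha)
    · intro a _
      exact hf a
  rw [← ZMod.natCast_eq_zero_iff_even]
  simpa using h

section BooleanFunctions

variable {n l : ℕ} (F : (Fin n → ZMod 2) → (Fin l → ZMod 2))

lemma add_add_self_zmod_two {ι : Type*} (x a : ι → ZMod 2) : x + a + a = x := by
  ext i
  simp [add_assoc, CharTwo.add_self_eq_zero]

lemma sub_comm_zmod_two {ι : Type*} (x y : ι → ZMod 2) : x - y = y - x := by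
  ext i
  simp [CharTwo.sub_eq_add, add_comm]

lemma even_deltaF {a : Fin n → ZMod 2} (ha : a ≠ 0) (b : Fin l → ZMod 2) :
    Even (deltaF F a b) := by
  refine even_card_filter_of_involution _ (fun x => x + a)
    (fun x => add_add_self_zmod_two x a) (fun x _ => by simpa using ha) ?_
  intro x hx
  rw [add_add_self_zmod_two, ← hx, sub_comm_zmod_two]

lemma sum_deltaF (a : Fin n → ZMod 2) : ∑ b, deltaF F a b = 2 ^ n := by
  unfold deltaF
  rw [← card_eq_sum_card_fiberwise (fun x _ => mem_univ _)]
  simp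

lemma sum_comp_derivative (a : Fin n → ZMod 2) (g : (Fin l → ZMod 2) → ℤ) :
    ∑ x, g (F (x + a) - F x) = ∑ b, (deltaF F a b : ℤ) * g b := by
  rw [← sum_fiberwise_of_maps_to (s := univ) (t := univ) (g := fun x => F (x + a) - F x)
    (fun x _ => mem_univ _)]
  refine sum_congr rfl fun b _ => ?_
  rw [sum_congr rfl (g := fun _ => g b) (by intro x hx; rw [(mem_filter.mp hx).2])]
  simp [deltaF]

lemma deltaF_derivative_eq_card (x a : Fin n → ZMod 2) :
    deltaF F a (F (x + a) - F x) =
      (univ.filter fun e => F (x + e + a) - F (x + e) = F (x + a) - F x).card := by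
  unfold deltaF
  refine (card_bij (fun e _ => x + e) ?_ ?_ ?_).symm
  · intro e he
    simpa using he
  · intro e _ e' _ h
    exact add_left_cancel h
  · intro y hy
    refine ⟨y - x, ?_, by abel⟩
    simpa using hy

/-- Over a hyperplane complement, the derivative multiplicities at `x` sum to a multiple of four. -/
lemma four_dvd_sum_deltaF (hn : 2 ≤ n) (x : Fin n → ZMod 2) (i : Fin n) :
    4 ∣ ∑ a ∈ univ.filter (fun a : Fin n → ZMod 2 => a i = 1),
      deltaF F a (F (x + a) - F x) := by
  set P : (Fin n → ZMod 2) → (Fin n → ZMod 2) → Prop :=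
    fun a e => F (x + e + a) - F (x + e) = F (x + a) - F x with hP
  have P_symm : ∀ a e, P a e → P e a := by
    intro a e h
    simp only [hP] at h ⊢
    rw [sub_eq_iff_eq_add] at h ⊢
    rw [add_right_comm, h]
    abel
  have P_add : ∀ a e, P a e → P a (e + a) := by
    intro a e h
    simp only [hP] at h ⊢
    rw [← add_assoc, add_add_self_zmod_two, ← h, sub_comm_zmod_two]
  have P_self : ∀ a, P a a := by
    intro a
    simp only [hP]
    rw [add_add_self_zmod_two, sub_comm_zmod_two]
  have bit : ∀ z : ZMod 2, z ≠ 1 ↔ z = 0 := by decide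
  have hsum : ∑ a ∈ univ.filter (fun a : Fin n → ZMod 2 => a i = 1),
      deltaF F a (F (x + a) - F x) =
      (univ.filter fun q : (Fin n → ZMod 2) × (Fin n → ZMod 2) =>
        q.1 i = 1 ∧ P q.1 q.2).card := by
    simp_rw [deltaF_derivative_eq_card, card_filter, sum_filter, Fintype.sum_prod_type]
    refine sum_congr rfl fun a _ => ?_
    by_cases h : a i = 1 <;> simp [h, hP]
  have hsplit : (univ.filter fun q : (Fin n → ZMod 2) × (Fin n → ZMod 2) =>
      q.1 i = 1 ∧ P q.1 q.2).card = 2 * (univ.filter fun q : (Fin n → ZMod 2) × (Fin n → ZMod 2) =>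
      (q.1 i = 1 ∧ P q.1 q.2) ∧ q.2 i = 1).card := by
    rw [← card_filter_add_card_filter_not (fun q => q.2 i = 1), filter_filter, filter_filter,
      two_mul]
    congr 1
    refine card_bij (fun q _ => (q.1, q.2 + q.1)) ?_ ?_ ?_
    · rintro ⟨a, e⟩ h
      simp only [mem_filter, mem_univ, true_and, bit] at h ⊢
      exact ⟨⟨h.1.1, P_add _ _ h.1.2⟩, by simp [h.1.1, h.2]⟩
    · rintro ⟨a, e⟩ _ ⟨a', e'⟩ _ h
      simp only [Prod.mk.injEq] at h ⊢
      obtain ⟨rfl, h⟩ := h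
      exact ⟨rfl, add_right_cancel h⟩
    · rintro ⟨a, e⟩ h
      simp only [mem_filter, mem_univ, true_and] at h
      refine ⟨(a, e + a), ?_, by simp [add_add_self_zmod_two]⟩
      simp only [mem_filter, mem_univ, true_and, bit]
      refine ⟨⟨h.1.1, P_add _ _ h.1.2⟩, ?_⟩
      simp only [Pi.add_apply, h.1.1, h.2]
      decide
  have hdiag : (univ.filter fun q : (Fin n → ZMod 2) × (Fin n → ZMod 2) =>
      ((q.1 i = 1 ∧ P q.1 q.2) ∧ q.2 i = 1) ∧ q.1 = q.2).card =
      (univ.filter fun a : Fin n → ZMod 2 => a i = 1).card := by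
    refine (card_bij (fun a _ => (a, a)) ?_ ?_ ?_).symm
    · intro a h
      simp only [mem_filter, mem_univ, true_and] at h ⊢
      exact ⟨⟨⟨h, P_self a⟩, h⟩, trivial⟩
    · intro a _ b _ h
      exact (Prod.mk.inj h).1
    · rintro ⟨a, e⟩ h
      simp only [mem_filter, mem_univ, true_and] at h
      obtain ⟨h, rfl⟩ := h
      exact ⟨a, by simpa using h.2, rfl⟩
  have hdiag_even : Even (univ.filter fun a : Fin n → ZMod 2 => a i = 1).card := by
    have : Nontrivial (Fin n) := Fin.nontrivial_iff_two_le.mpr hn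
    obtain ⟨j, hj⟩ := exists_ne i
    refine even_card_filter_of_involution _ (fun a => a + Pi.single j 1)
      (fun a => add_add_self_zmod_two _ _) (fun a _ h => ?_) (fun a h => ?_)
    · simpa using congrFun h j
    · simpa [Pi.single_eq_of_ne hj.symm] using h
  have hoff_even : Even (univ.filter fun q : (Fin n → ZMod 2) × (Fin n → ZMod 2) =>
      ((q.1 i = 1 ∧ P q.1 q.2) ∧ q.2 i = 1) ∧ ¬ q.1 = q.2).card := by
    refine even_card_filter_of_involution _ Prod.swap Prod.swap_swap ?_ ?_
    · rintro ⟨a, e⟩ h h'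
      exact h.2 (Prod.mk.inj h').2
    · rintro ⟨a, e⟩ h
      exact ⟨⟨⟨h.1.2, P_symm _ _ h.1.1.2⟩, h.1.1.1⟩, fun h' => h.2 h'.symm⟩
  have heven : Even (univ.filter fun q : (Fin n → ZMod 2) × (Fin n → ZMod 2) =>
      (q.1 i = 1 ∧ P q.1 q.2) ∧ q.2 i = 1).card := by
    rw [← card_filter_add_card_filter_not (fun q => q.1 = q.2), filter_filter, filter_filter, hdiag]
    exact hdiag_even.add hoff_even
  rw [hsum, hsplit]
  obtain ⟨r, hr⟩ := heven
  exact ⟨r, by omega⟩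

/-- The directions whose fibre through `x` is an odd number of pairs meet every hyperplane
complement in an even number of points. -/
lemma even_card_odd_directions (hn : 2 ≤ n) (x : Fin n → ZMod 2) (i : Fin n) :
    Even (univ.filter fun a : Fin n → ZMod 2 =>
      a i = 1 ∧ deltaF F a (F (x + a) - F x) % 4 = 2).card := by
  have h := four_dvd_sum_deltaF F hn x i
  have hval : ∀ a ∈ univ.filter (fun a : Fin n → ZMod 2 => a i = 1),
      deltaF F a (F (x + a) - F x) ≡
        2 * (if deltaF F a (F (x + a) - F x) % 4 = 2 then 1 else 0) [MOD 4] := by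
    intro a ha
    have ha0 : a ≠ 0 := by
      rintro rfl
      simp at ha
    obtain ⟨r, hr⟩ := even_deltaF F ha0 (F (x + a) - F x)
    unfold Nat.ModEq
    split_ifs with h2 <;> omega
  have h' : 4 ∣ 2 * (univ.filter fun a : Fin n → ZMod 2 =>
      a i = 1 ∧ deltaF F a (F (x + a) - F x) % 4 = 2).card := by
    rw [← filter_filter, card_filter, mul_sum]
    refine (Nat.ModEq.dvd_iff ?_ (dvd_refl 4)).mp h
    exact Nat.ModEq.sum hval
  rw [even_iff_two_dvd]
  omega

lemma two_le_card_odd_directions (hn : 2 ≤ n) (x : Fin n → ZMod 2) {a₀ : Fin n → ZMod 2}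
    (ha₀ : a₀ ≠ 0) (hodd : deltaF F a₀ (F (x + a₀) - F x) % 4 = 2) :
    2 ≤ (((univ.filter fun a : Fin n → ZMod 2 => a ≠ 0).erase a₀).filter fun a =>
      deltaF F a (F (x + a) - F x) % 4 = 2).card := by
  have bit : ∀ z : ZMod 2, z ≠ 0 → z = 1 := by decide
  have bit' : ∀ z w : ZMod 2, z ≠ w → (z = 1 ∧ w ≠ 1) ∨ (w = 1 ∧ z ≠ 1) := by decide
  have extend : ∀ (i : Fin n) (a : Fin n → ZMod 2), a i = 1 →
      deltaF F a (F (x + a) - F x) % 4 = 2 →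
      ∃ c, c ≠ a ∧ c i = 1 ∧ deltaF F c (F (x + c) - F x) % 4 = 2 := by
    intro i a hi ha
    have heven := even_card_odd_directions F hn x i
    have hpos : 0 < (univ.filter fun a : Fin n → ZMod 2 =>
        a i = 1 ∧ deltaF F a (F (x + a) - F x) % 4 = 2).card :=
      card_pos.mpr ⟨a, by simp [hi, ha]⟩
    obtain ⟨c, hc, hca⟩ := exists_mem_ne (by obtain ⟨r, hr⟩ := heven; rw [hr] at hpos ⊢; omega) a
    exact ⟨c, hca, by simpa using hc⟩
  obtain ⟨i, hi⟩ := Function.ne_iff.mp ha₀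
  obtain ⟨c, hca, hci, hc⟩ := extend i a₀ (bit _ hi) hodd
  obtain ⟨j, hj⟩ := Function.ne_iff.mp hca
  have third : ∃ d, d ≠ a₀ ∧ d ≠ c ∧ d j = 1 ∧ deltaF F d (F (x + d) - F x) % 4 = 2 := by
    rcases bit' _ _ hj with ⟨h1, h2⟩ | ⟨h1, h2⟩
    · obtain ⟨d, hd, hdj, hdo⟩ := extend j c h1 hc
      exact ⟨d, fun h => h2 (h ▸ hdj), hd, hdj, hdo⟩
    · obtain ⟨d, hd, hdj, hdo⟩ := extend j a₀ h1 hodd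
      exact ⟨d, hd, fun h => h2 (h ▸ hdj), hdj, hdo⟩
  obtain ⟨d, hda, hdc, hdj, hd⟩ := third
  have hc0 : c ≠ 0 := by
    rintro rfl
    simp at hci
  have hd0 : d ≠ 0 := by
    rintro rfl
    simp at hdj
  refine (card_pair hdc).symm.trans_le (card_le_card ?_)
  intro e he
  simp only [mem_insert, mem_singleton] at he
  rcases he with rfl | rfl
  · simp [hda, hd0, hd]
  · simp [hca, hc0, hc]

end BooleanFunctions

section LowerBound

variable {n : ℕ} (F : (Fin n → ZMod 2) → (Fin (n - 2) → ZMod 2))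

lemma sum_deltaF_sub_four (hn : 2 ≤ n) (a : Fin n → ZMod 2) :
    ∑ b, ((deltaF F a b : ℤ) - 4) = 0 := by
  have h : (∑ b, (deltaF F a b : ℤ)) = 2 ^ n := by exact_mod_cast sum_deltaF F a
  obtain ⟨r, rfl⟩ := Nat.exists_eq_add_of_le hn
  rw [sum_sub_distrib, h]
  simp [pow_add]
  ring

lemma sum_odd_fibres_le (hn : 2 ≤ n) {a : Fin n → ZMod 2} :
    ∑ b, (deltaF F a b : ℤ) * (if deltaF F a b % 4 = 2 then 1 else 0) ≤
      ∑ b, ((deltaF F a b : ℤ) - 4) ^ 2 := by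
  have h : ∑ b, ((deltaF F a b : ℤ) - 4) ^ 2 =
      ∑ b, (((deltaF F a b : ℤ) - 4) ^ 2 + ((deltaF F a b : ℤ) - 4)) := by
    rw [sum_add_distrib, sum_deltaF_sub_four F hn, add_zero]
  rw [h]
  refine sum_le_sum fun b _ => ?_
  generalize deltaF F a b = d
  split_ifs with hd
  · have : d = 2 ∨ 6 ≤ d := by omega
    rcases this with rfl | h6
    · norm_num
    · have : (6 : ℤ) ≤ d := by exact_mod_cast h6
      nlinarith
  · rcases le_or_gt 4 d with h4 | h4
    · have : (4 : ℤ) ≤ d := by exact_mod_cast h4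
      nlinarith
    · interval_cases d <;> norm_num

lemma two_mul_sum_odd_fibres_le (hn : 2 ≤ n) {a₀ : Fin n → ZMod 2} (ha₀ : a₀ ≠ 0) :
    2 * ∑ b, (deltaF F a₀ b : ℤ) * (if deltaF F a₀ b % 4 = 2 then 1 else 0) ≤
      ∑ a ∈ (univ.filter fun a : Fin n → ZMod 2 => a ≠ 0).erase a₀,
        ∑ b, ((deltaF F a b : ℤ) - 4) ^ 2 := by
  refine le_trans ?_ (sum_le_sum fun a _ => sum_odd_fibres_le F hn)
  simp_rw [← sum_comp_derivative F _ fun b => if deltaF F _ b % 4 = 2 then (1 : ℤ) else 0]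
  rw [sum_comm, mul_sum]
  refine sum_le_sum fun x _ => ?_
  rw [← sum_filter, sum_const, nsmul_one]
  split_ifs with h
  · exact_mod_cast two_le_card_odd_directions F hn x ha₀ h
  · simp

lemma mul_sub_four_le_sum_sq (hn : 2 ≤ n) {a₀ : Fin n → ZMod 2} (ha₀ : a₀ ≠ 0)
    (b₀ : Fin (n - 2) → ZMod 2) :
    (deltaF F a₀ b₀ : ℤ) * (deltaF F a₀ b₀ - 4) ≤
      ∑ a ∈ univ.filter (fun a : Fin n → ZMod 2 => a ≠ 0),
        ∑ b, ((deltaF F a b : ℤ) - 4) ^ 2 := by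
  have hrest := two_mul_sum_odd_fibres_le F hn ha₀
  rw [← add_sum_erase _ _ (by simpa using ha₀ : a₀ ∈ univ.filter fun a => a ≠ 0)]
  refine le_trans ?_ (add_le_add_right hrest _)
  have hzero := sum_deltaF_sub_four F hn a₀
  rw [← add_sum_erase _ _ (mem_univ b₀)] at hzero
  rw [mul_sum, ← sum_add_distrib, ← add_sum_erase _ _ (mem_univ b₀)]
  have hcells : ∑ b ∈ univ.erase b₀, (-4) * ((deltaF F a₀ b : ℤ) - 4) ≤
      ∑ b ∈ univ.erase b₀, (((deltaF F a₀ b : ℤ) - 4) ^ 2 +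
        2 * ((deltaF F a₀ b : ℤ) * (if deltaF F a₀ b % 4 = 2 then 1 else 0))) := by
    refine sum_le_sum fun b _ => ?_
    obtain ⟨r, hr⟩ := even_deltaF F ha₀ b
    generalize deltaF F a₀ b = d at hr
    split_ifs with hd
    · have : (2 : ℤ) ≤ d := by exact_mod_cast (by omega : 2 ≤ d)
      nlinarith
    · have : d = 0 ∨ 4 ≤ d := by omega
      rcases this with rfl | h4
      · norm_num
      · have : (4 : ℤ) ≤ d := by exact_mod_cast h4
        nlinarith
  rw [← mul_sum] at hcells
  have hnonneg : (0 : ℤ) ≤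
      2 * ((deltaF F a₀ b₀ : ℤ) * (if deltaF F a₀ b₀ % 4 = 2 then 1 else 0)) := by
    positivity
  nlinarith

lemma ambiguity_eq_sum_sq (hn : 2 ≤ n) :
    (ambiguity F : ℚ) = 3 * 2 ^ (n - 1) * ((2 : ℚ) ^ n - 1) +
      ((∑ a ∈ univ.filter (fun a : Fin n → ZMod 2 => a ≠ 0),
        ∑ b, ((deltaF F a b : ℤ) - 4) ^ 2 : ℤ) : ℚ) / 2 := by
  have hrow : ∀ a : Fin n → ZMod 2, ∑ b, ((deltaF F a b).choose 2 : ℚ) =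
      3 * 2 ^ (n - 1) + (∑ b, ((deltaF F a b : ℚ) - 4) ^ 2) / 2 := by
    intro a
    have hzero : ∑ b, ((deltaF F a b : ℚ) - 4) = 0 := by
      exact_mod_cast sum_deltaF_sub_four F hn a
    have hcell : ∀ b, ((deltaF F a b).choose 2 : ℚ) =
        6 + 7 / 2 * ((deltaF F a b : ℚ) - 4) + ((deltaF F a b : ℚ) - 4) ^ 2 / 2 := by
      intro b
      rw [Nat.cast_choose_two]
      ring
    simp_rw [hcell]
    rw [sum_add_distrib, sum_add_distrib, ← mul_sum, hzero, ← sum_div]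
    obtain ⟨r, rfl⟩ := Nat.exists_eq_add_of_le hn
    rw [show 2 + r - 1 = r + 1 by omega]
    simp
    ring
  have hcard : ((univ.filter fun a : Fin n → ZMod 2 => a ≠ 0).card : ℚ) = 2 ^ n - 1 := by
    rw [filter_ne', card_erase_of_mem (mem_univ _), Nat.cast_sub (by simp [Nat.one_le_two_pow])]
    simp
  unfold ambiguity
  push_cast
  simp_rw [hrow]
  rw [sum_add_distrib, ← sum_div, sum_const, nsmul_eq_mul, hcard]
  ring

end LowerBound

lemma exists_deltaF_eq_diffUnif {n l : ℕ} (hn : 0 < n)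
    (F : (Fin n → ZMod 2) → (Fin l → ZMod 2)) :
    ∃ a, a ≠ 0 ∧ ∃ b, deltaF F a b = diffUnif F := by
  have hne : (univ.filter fun a : Fin n → ZMod 2 => a ≠ 0).Nonempty :=
    ⟨fun _ => 1, by simpa using Function.ne_iff.mpr ⟨⟨0, hn⟩, by simp⟩⟩
  obtain ⟨a, ha, hmax⟩ := exists_mem_eq_sup _ hne fun a => univ.sup fun b => deltaF F a b
  obtain ⟨b, -, hb⟩ := exists_mem_eq_sup univ univ_nonempty fun b => deltaF F a b
  exact ⟨a, by simpa using ha, b, by rw [diffUnif, hmax, hb]⟩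

theorem ambiguity_lower_bound_n_minus_two {n : ℕ} (hn : 3 ≤ n)
    (F : (Fin n → ZMod 2) → (Fin (n - 2) → ZMod 2)) (k : ℕ) (hk : k = diffUnif F)
    (δk : ℚ) (hδk : δk = if k % 4 = 0 then 0 else 2) :
    3 * 2 ^ (n - 1) * ((2 : ℚ) ^ n - 1) + (k : ℚ) * ((k : ℚ) - 4) / 2 - δk ≤
      (ambiguity F : ℚ) := by
  obtain ⟨a, ha, b, hab⟩ := exists_deltaF_eq_diffUnif (by omega) F
  have h := mul_sub_four_le_sum_sq F (by omega) ha b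
  rw [hab, ← hk] at h
  have hδ : 0 ≤ δk := by
    rw [hδk]
    split_ifs <;> norm_num
  rw [ambiguity_eq_sum_sq F (by omega)]
  have h' : (k : ℚ) * ((k : ℚ) - 4) ≤ ((∑ a ∈ univ.filter (fun a : Fin n → ZMod 2 => a ≠ 0),
      ∑ b, ((deltaF F a b : ℤ) - 4) ^ 2 : ℤ) : ℚ) := by
    exact_mod_cast h
  linarith
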